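/- For α ∈ Z^m with ℓ(D_α) > 0, there exists a unique β ∈ T_α whose norm |β| is minimum among {|γ| : γ ∈ T_α}. -/

import Mathlib

open scoped Classical

/-- Abstract divisor-theoretic data of a nonsingular, projective, geometrically
irreducible algebraic curve over a field `Fq`: a function field `K`, a set of
closed points with their degrees, a genus, and the normalized discrete
valuations of `K` at the closed points (with the junk convention `v P 0 = 0`). -/
structure Curve (Fq : Type) [Field Fq] where
  /-- the function field of the curve -/
  K : Type
  [fieldK : Field K]
  [algebraK : Algebra Fq K]
  /-- the closed points of the curve -/
  Point : Type
  /-- the degree of a closed point -/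
  deg : Point → ℕ
  deg_pos : ∀ P, 0 < deg P
  /-- the genus of the curve -/
  genus : ℕ
  /-- the normalized discrete valuation at a closed point -/
  v : Point → K → ℤ
  v_zero : ∀ P, v P 0 = 0
  v_mul : ∀ (P : Point) {x y : K}, x ≠ 0 → y ≠ 0 → v P (x * y) = v P x + v P y
  v_min_le_add : ∀ (P : Point) {x y : K}, x ≠ 0 → y ≠ 0 → x + y ≠ 0 →
    min (v P x) (v P y) ≤ v P (x + y)
  v_algebraMap : ∀ (P : Point) (c : Fq), c ≠ 0 → v P (algebraMap Fq K c) = 0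
  v_surjective : ∀ P : Point, ∃ x : K, x ≠ 0 ∧ v P x = 1
  /-- a nonzero function has only finitely many zeros and poles -/
  support_finite : ∀ {x : K}, x ≠ 0 → {P : Point | v P x ≠ 0}.Finite
  /-- a function without poles is constant (the curve is projective and
  geometrically irreducible) -/
  no_pole_constant : ∀ {x : K}, x ≠ 0 → (∀ P, 0 ≤ v P x) → ∃ c : Fq, x = algebraMap Fq K c
  /-- principal divisors have degree zero -/
  degree_principal : ∀ {x : K}, x ≠ 0 → ∑ᶠ P : Point, (deg P : ℤ) * v P x = 0

attribute [instance] Curve.fieldK Curve.algebraK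

namespace Curve

variable {Fq : Type} [Field Fq] [Fintype Fq]

/-- The degree of a divisor. -/
noncomputable def degDiv (C : Curve Fq) (D : C.Point →₀ ℤ) : ℤ :=
  D.sum fun P n => (C.deg P : ℤ) * n

/-- The Riemann–Roch space `L(D)`. -/
def Lset (C : Curve Fq) (D : C.Point →₀ ℤ) : Set C.K :=
  {h | h = 0 ∨ ∀ P : C.Point, 0 ≤ C.v P h + D P}

/-- `ℓ(D)`, the dimension of `L(D)` as an `Fq`-vector space. -/
noncomputable def ell (C : Curve Fq) (D : C.Point →₀ ℤ) : ℕ :=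
  Module.finrank Fq (Submodule.span Fq (C.Lset D))

/-- The divisor `D` is principal. -/
def IsPrincipalDiv (C : Curve Fq) (D : C.Point →₀ ℤ) : Prop :=
  ∃ h : C.K, h ≠ 0 ∧ ∀ P : C.Point, C.v P h = D P

/-- The divisor `D_α = α₁Q₁ + ⋯ + α_mQ_m`. -/
noncomputable def Dt (C : Curve Fq) {m : ℕ} (Q : Fin m → C.Point) (α : Fin m → ℤ) :
    C.Point →₀ ℤ :=
  ∑ i, Finsupp.single (Q i) (α i)

/-- The generalized Weierstrass semigroup `Ĥ(Q)`: the set of tuples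
`(-v_{Q_1}(h), …, -v_{Q_m}(h))` for nonzero `h` having poles only in `{Q_1, …, Q_m}`. -/
def Hhat (C : Curve Fq) {m : ℕ} (Q : Fin m → C.Point) : Set (Fin m → ℤ) :=
  {α | ∃ h : C.K, h ≠ 0 ∧ (∀ P : C.Point, P ∉ Set.range Q → 0 ≤ C.v P h) ∧
    ∀ i, α i = -C.v (Q i) h}

/-- `∇_J(α)`. -/
def nabla (C : Curve Fq) {m : ℕ} (Q : Fin m → C.Point) (J : Set (Fin m))
    (α : Fin m → ℤ) : Set (Fin m → ℤ) :=
  {β | β ∈ C.Hhat Q ∧ (∀ j ∈ J, β j = α j) ∧ ∀ i ∉ J, β i < α i}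

/-- `∇_i^m(α)`. -/
def nablaI (C : Curve Fq) {m : ℕ} (Q : Fin m → C.Point) (i : Fin m) (α : Fin m → ℤ) :
    Set (Fin m → ℤ) :=
  {β | β ∈ C.Hhat Q ∧ β i = α i ∧ ∀ j, j ≠ i → β j ≤ α j}

/-- `Γ̂(Q)`, the set of absolute maximal elements of `Ĥ(Q)`. -/
def Gammahat (C : Curve Fq) {m : ℕ} (Q : Fin m → C.Point) : Set (Fin m → ℤ) :=
  {α | α ∈ C.Hhat Q ∧
    ∀ J : Set (Fin m), J.Nonempty → J ≠ Set.univ → C.nabla Q J α = ∅}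

/-- `Γ̂_Q(α) = {β ∈ Γ̂(Q) : β ≤ α}`. -/
def GammahatLe (C : Curve Fq) {m : ℕ} (Q : Fin m → C.Point) (α : Fin m → ℤ) :
    Set (Fin m → ℤ) :=
  {β | β ∈ C.Gammahat Q ∧ ∀ i, β i ≤ α i}

/-- The divisor `A` is a discrepancy with respect to `P` and `Q'`. -/
def IsDiscrepancy (C : Curve Fq) (A : C.Point →₀ ℤ) (P Q' : C.Point) : Prop :=
  C.Lset A ≠ C.Lset (A - Finsupp.single Q' 1) ∧
  C.Lset (A - Finsupp.single P 1) = C.Lset (A - Finsupp.single P 1 - Finsupp.single Q' 1)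

/-- `T_α = {β ∈ ℤ^m : β ≤ α and ℓ(D_β) = ℓ(D_α)}`. -/
def Tset (C : Curve Fq) {m : ℕ} (Q : Fin m → C.Point) (α : Fin m → ℤ) :
    Set (Fin m → ℤ) :=
  {β | (∀ j, β j ≤ α j) ∧ C.ell (C.Dt Q β) = C.ell (C.Dt Q α)}

/-- `D_β` is the supported floor `⌊D_α⌋_Q`: `β` is the element of `T_α` of minimum
norm `|β| = β₁ + ⋯ + β_m`. -/
def IsSuppFloor (C : Curve Fq) {m : ℕ} (Q : Fin m → C.Point) (α β : Fin m → ℤ) : Prop :=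
  β ∈ C.Tset Q α ∧ ∀ γ ∈ C.Tset Q α, ∑ i, β i ≤ ∑ i, γ i

/-- `G'` is the floor `⌊G⌋` of `G`: among all divisors with the same Riemann–Roch
space as `G`, it has minimum degree. -/
def IsFloorDiv (C : Curve Fq) (G G' : C.Point →₀ ℤ) : Prop :=
  C.Lset G' = C.Lset G ∧
  ∀ G'' : C.Point →₀ ℤ, C.Lset G'' = C.Lset G → C.degDiv G' ≤ C.degDiv G''

end Curve

namespace Curve

section RiemannRochSpace

variable {F : Type} [Field F]

/-- The Riemann–Roch space `L(D)` as a subspace of the function field. -/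
def riemannRochSubmodule (C : Curve F) (D : C.Point →₀ ℤ) : Submodule F C.K where
  carrier := C.Lset D
  zero_mem' := Or.inl rfl
  add_mem' := by
    intro x y hx hy
    by_cases hx0 : x = 0
    · simpa [hx0] using hy
    by_cases hy0 : y = 0
    · simpa [hy0] using hx
    by_cases hxy : x + y = 0
    · exact Or.inl hxy
    refine Or.inr fun P => ?_
    have h1 := C.v_min_le_add P hx0 hy0 hxy
    have h2 := hx.resolve_left hx0 P
    have h3 := hy.resolve_left hy0 P
    omega
  smul_mem' := by
    intro c x hx
    by_cases hx0 : x = 0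
    · exact Or.inl (by simp [hx0])
    by_cases hc : c = 0
    · exact Or.inl (by simp [hc])
    refine Or.inr fun P => ?_
    have hc' : algebraMap F C.K c ≠ 0 := by simpa using hc
    rw [Algebra.smul_def, C.v_mul P hc' hx0, C.v_algebraMap P c hc, zero_add]
    exact hx.resolve_left hx0 P

theorem span_Lset (C : Curve F) (D : C.Point →₀ ℤ) :
    Submodule.span F (C.Lset D) = C.riemannRochSubmodule D :=
  Submodule.span_eq (C.riemannRochSubmodule D)

theorem ell_eq_finrank (C : Curve F) (D : C.Point →₀ ℤ) :
    C.ell D = Module.finrank F (C.riemannRochSubmodule D) := by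
  rw [ell, span_Lset]

theorem Lset_mono (C : Curve F) {D E : C.Point →₀ ℤ} (h : D ≤ E) : C.Lset D ⊆ C.Lset E := by
  rintro x (hx | hx)
  · exact Or.inl hx
  · exact Or.inr fun P => (hx P).trans (by have := h P; omega)

theorem Lset_eq_of_le_of_ell_eq (C : Curve F) {D E : C.Point →₀ ℤ} (h : D ≤ E)
    (hpos : 0 < C.ell E) (hell : C.ell D = C.ell E) : C.Lset D = C.Lset E := by
  rw [ell_eq_finrank] at hpos
  rw [ell_eq_finrank, ell_eq_finrank] at hell
  have := Module.finite_of_finrank_pos hpos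
  exact congrArg SetLike.coe (Submodule.eq_of_le_of_finrank_eq
    (S₁ := C.riemannRochSubmodule D) (S₂ := C.riemannRochSubmodule E) (C.Lset_mono h) hell)

theorem exists_ne_zero_mem_Lset (C : Curve F) {D : C.Point →₀ ℤ} (hpos : 0 < C.ell D) :
    ∃ x ∈ C.Lset D, x ≠ 0 := by
  rw [ell_eq_finrank] at hpos
  have := Module.nontrivial_of_finrank_pos hpos
  exact (Submodule.ne_bot_iff _).mp (Submodule.nontrivial_iff_ne_bot.mp this)

variable (C : Curve F) {m : ℕ} {Q : Fin m → C.Point}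

theorem Dt_apply (hQ : Function.Injective Q) (α : Fin m → ℤ) (i : Fin m) :
    C.Dt Q α (Q i) = α i := by
  simp [Dt, Finsupp.finsetSum_apply, Finsupp.single_apply, hQ.eq_iff]

theorem Dt_apply_of_notMem_range (α : Fin m → ℤ) {P : C.Point} (hP : P ∉ Set.range Q) :
    C.Dt Q α P = 0 := by
  rw [Dt, Finsupp.finsetSum_apply]
  exact Finset.sum_eq_zero fun i _ => Finsupp.single_eq_of_ne fun h => hP ⟨i, h.symm⟩

theorem Dt_mono {α β : Fin m → ℤ} (h : β ≤ α) : C.Dt Q β ≤ C.Dt Q α :=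
  Finset.sum_le_sum fun i _ => Finsupp.single_le_single.mpr (h i)

/-- The set `T_α` has a least element: its `i`-th coordinate is the largest pole order at `Q i`
of a nonzero function in `L(D_α)`. -/
theorem exists_isLeast_Tset (hQ : Function.Injective Q) {α : Fin m → ℤ}
    (hα : 0 < C.ell (C.Dt Q α)) : ∃ β, IsLeast (C.Tset Q α) β := by
  obtain ⟨x₀, hx₀, hne⟩ := C.exists_ne_zero_mem_Lset hα
  have pole_le {γ : Fin m → ℤ} {x : C.K} (hx : x ∈ C.Lset (C.Dt Q γ)) (hx0 : x ≠ 0)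
      (i : Fin m) : -C.v (Q i) x ≤ γ i := by
    have h := hx.resolve_left hx0 (Q i)
    rw [C.Dt_apply hQ] at h
    omega
  have hmax (i : Fin m) : ∃ b : ℤ, (∃ x ∈ C.Lset (C.Dt Q α), x ≠ 0 ∧ -C.v (Q i) x = b) ∧
      ∀ z : ℤ, (∃ x ∈ C.Lset (C.Dt Q α), x ≠ 0 ∧ -C.v (Q i) x = z) → z ≤ b := by
    refine Int.exists_greatest_of_bdd ⟨α i, ?_⟩ ⟨_, x₀, hx₀, hne, rfl⟩
    rintro _ ⟨x, hx, hx0, rfl⟩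
    exact pole_le hx hx0 i
  choose β hβ hβmax using hmax
  have hle : β ≤ α := fun i => by
    obtain ⟨x, hx, hx0, h⟩ := hβ i
    exact h ▸ pole_le hx hx0 i
  have hsub : C.Lset (C.Dt Q α) ⊆ C.Lset (C.Dt Q β) := by
    intro x hx
    by_cases hx0 : x = 0
    · exact Or.inl hx0
    refine Or.inr fun P => ?_
    by_cases hP : P ∈ Set.range Q
    · obtain ⟨i, rfl⟩ := hP
      have h := hβmax i _ ⟨x, hx, hx0, rfl⟩
      rw [C.Dt_apply hQ]
      omega
    · have h := hx.resolve_left hx0 P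
      rw [C.Dt_apply_of_notMem_range α hP] at h
      rwa [C.Dt_apply_of_notMem_range β hP]
  refine ⟨β, ⟨hle, ?_⟩, ?_⟩
  · rw [ell, ell, (C.Lset_mono (C.Dt_mono hle)).antisymm hsub]
  · rintro γ ⟨hγle, hγ⟩ i
    obtain ⟨x, hx, hx0, h⟩ := hβ i
    rw [← C.Lset_eq_of_le_of_ell_eq (C.Dt_mono hγle) hα hγ] at hx
    exact h ▸ pole_le hx hx0 i

end RiemannRochSpace

end Curve

/-- Proposition 3.2: for `α ∈ ℤ^m` with `ℓ(D_α) > 0`, there is a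
unique `β ∈ T_α` whose norm `|β|` is minimum among `{|γ| : γ ∈ T_α}`. -/
theorem statement1 {Fq : Type} [Field Fq] [Fintype Fq] (C : Curve Fq)
    (hgenus : 0 < C.genus) (K₀ : C.Point →₀ ℤ)
    (hRR : ∀ D : C.Point →₀ ℤ,
      (C.ell D : ℤ) - C.ell (K₀ - D) = C.degDiv D + 1 - C.genus)
    {m : ℕ} (hm : 2 ≤ m) (Q : Fin m → C.Point)
    (hQinj : Function.Injective Q) (hQdeg : ∀ i, C.deg (Q i) = 1)
    (α : Fin m → ℤ) (hα : 0 < C.ell (C.Dt Q α)) :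
    ∃! β : Fin m → ℤ, β ∈ C.Tset Q α ∧ ∀ γ ∈ C.Tset Q α, ∑ i, β i ≤ ∑ i, γ i := by
  obtain ⟨β, hβ, hleast⟩ := C.exists_isLeast_Tset hQinj hα
  refine ⟨β, ⟨hβ, fun γ hγ => Finset.sum_le_sum fun i _ => hleast hγ i⟩, ?_⟩
  rintro γ ⟨hγ, hmin⟩
  have hle := hleast hγ
  have hsum := (Finset.sum_le_sum fun i _ => hle i).antisymm (hmin β hβ)
  exact funext fun i =>
    ((Finset.sum_eq_sum_iff_of_le fun i _ => hle i).mp hsum i (Finset.mem_univ i)).symm
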